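/- Let m ∈ (ℕ*)^d and κ_m = √(2·d!) √(Σ_{i=1}^d (m_i+d)^{2d}). Then for every g in the linear span S_m of (φ_{i,k}(x_i); 1 ≤ k ≤ m_i, 1 ≤ i ≤ d) on △, ‖g‖_∞ ≤ κ_m ‖g‖_{L^2(△)}. -/

import Mathlib

open MeasureTheory Real

def simplexD (d : ℕ) : Set (Fin d → ℝ) :=
  {x | (∀ i, x i ∈ Set.Icc (0:ℝ) 1) ∧ ∀ i j : Fin d, i ≤ j → x i ≤ x j}

noncomputable def qMeas (d i : ℕ) : Measure ℝ :=
  volume.withDensity (fun t => ENNReal.ofReal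
    (Set.indicator (Set.Icc (0:ℝ) 1)
      (fun s => (1-s)^(d-i) * s^(i-1) / ((d-i).factorial * (i-1).factorial)) t))

noncomputable def jacobiP (a b k : ℕ) (t : ℝ) : ℝ :=
  (-1)^k / ((2:ℝ)^k * (k.factorial : ℝ) * ((1-t)^a * (1+t)^b)) *
    iteratedDeriv k (fun s => (1-s)^a * (1+s)^b * (1-s^2)^k) t

noncomputable def phiB (d i k : ℕ) (t : ℝ) : ℝ :=
  Real.sqrt ((((2*k+d) * k.factorial * (k+d-1).factorial : ℕ) : ℝ) /
      (((k+d-i).factorial * (k+i-1).factorial : ℕ) : ℝ)) *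
  Real.sqrt (((d-i).factorial * (i-1).factorial : ℕ) : ℝ) *
  jacobiP (d-i) (i-1) k (2*t-1)

noncomputable def lincomb (d : ℕ) (m : Fin d → ℕ) (θ : (i : Fin d) → Fin (m i) → ℝ)
    (x : Fin d → ℝ) : ℝ :=
  ∑ i, ∑ k, θ i k * phiB d (i.1+1) (k.1+1) (x i)

noncomputable def psiFun (d : ℕ) (m : Fin d → ℕ) (θ : (i : Fin d) → Fin (m i) → ℝ) : ℝ :=
  Real.log (∫ x in simplexD d, Real.exp (lincomb d m θ x))

noncomputable def fdens (d : ℕ) (m : Fin d → ℕ) (θ : (i : Fin d) → Fin (m i) → ℝ)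
    (x : Fin d → ℝ) : ℝ :=
  Real.exp (lincomb d m θ x - psiFun d m θ)

noncomputable def Amap (d : ℕ) (m : Fin d → ℕ) (θ : (i : Fin d) → Fin (m i) → ℝ) :
    (i : Fin d) → Fin (m i) → ℝ :=
  fun i k => ∫ x in simplexD d, phiB d (i.1+1) (k.1+1) (x i) * fdens d m θ x

noncomputable def eunorm (d : ℕ) (m : Fin d → ℕ) (θ : (i : Fin d) → Fin (m i) → ℝ) : ℝ :=
  Real.sqrt (∑ i, ∑ k, (θ i k)^2)

open Polynomial in
theorem kern_exists (n d : ℕ) (hd : 1 ≤ d) : ∃ c : ℕ → ℝ,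
    (∀ i ≤ n, ∑ j ∈ Finset.range (n+1), c j / ((i:ℝ)+j+d) = if i = 0 then 1 else 0) ∧
    c 0 = d * ((n+d).choose d : ℝ)^2 := by
  classical
  set v : ℕ → ℝ := fun j => -((j:ℝ)+d) with hv
  set s := Finset.range (n+1) with hs
  have hvinj : Set.InjOn v s := by
    intro a _ b _ h
    simp only [hv] at h
    have : (a:ℝ) = b := by linarith
    exact_mod_cast this
  set N : ℝ[X] := ∏ i ∈ Finset.range n, (X - C ((i:ℝ)+1)) with hN
  have hNdeg : N.degree < s.card := by
    rw [hN, Polynomial.degree_prod, Finset.sum_congr rfl fun i _ => degree_X_sub_C _]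
    simp only [hs, Finset.sum_const, Finset.card_range, nsmul_eq_mul, mul_one]
    exact_mod_cast Nat.lt_succ_self n
  have hfact := Lagrange.eq_interpolate hvinj hNdeg
  have key : ∀ x : ℝ, 0 ≤ x → N.eval x = (Lagrange.nodal s v).eval x *
      ∑ j ∈ s, Lagrange.nodalWeight s v j * (x - v j)⁻¹ * N.eval (v j) := by
    intro x hx
    conv_lhs => rw [hfact]
    rw [Lagrange.eval_interpolate_not_at_node]
    intro i hi h
    simp only [hv] at h
    have : (1:ℝ) ≤ d := by exact_mod_cast hd
    have : (0:ℝ) ≤ i := by positivity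
    linarith
  have hnod : ∀ x : ℝ, 0 ≤ x → (Lagrange.nodal s v).eval x ≠ 0 := by
    intro x hx
    rw [Lagrange.eval_nodal, Finset.prod_ne_zero_iff]
    intro j hj
    have : (1:ℝ) ≤ d := by exact_mod_cast hd
    have : (0:ℝ) ≤ j := by positivity
    simp only [hv]
    intro h
    linarith
  have hN0 : N.eval 0 ≠ 0 := by
    rw [hN, eval_prod, Finset.prod_ne_zero_iff]
    intro j hj
    simp only [eval_sub, eval_X, eval_C, zero_sub]
    have : (0:ℝ) < (j:ℝ)+1 := by positivity
    linarith
  set A : ℝ := (Lagrange.nodal s v).eval 0 / N.eval 0 with hA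
  refine ⟨fun j => A * (Lagrange.nodalWeight s v j * N.eval (v j)), ?_, ?_⟩
  · intro i hi
    have h1 := key i (by positivity)
    have h2 : ∑ j ∈ s, A * (Lagrange.nodalWeight s v j * N.eval (v j)) / ((i:ℝ)+j+d)
        = A * (N.eval (i:ℝ) / (Lagrange.nodal s v).eval (i:ℝ)) := by
      rw [h1, mul_div_cancel_left₀ _ (hnod i (by positivity)), Finset.mul_sum]
      refine Finset.sum_congr rfl fun j _ => ?_
      have : (i:ℝ) - v j = i + j + d := by simp only [hv]; ring
      rw [this]; ring
    rw [h2]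
    split_ifs with h0
    · subst h0
      have := hnod 0 le_rfl
      simp only [Nat.cast_zero, hA]
      field_simp
    · have : N.eval (i:ℝ) = 0 := by
        rw [hN, eval_prod]
        apply Finset.prod_eq_zero (i := i-1)
        · simp; omega
        · have : ((i-1:ℕ):ℝ) + 1 = i := by
            rw [Nat.cast_sub (by omega)]; simp
          simp [this]
      rw [this]; simp
  · have e1 : (Lagrange.nodal s v).eval 0 = d * ∏ j ∈ Finset.range n, ((j:ℝ)+1+d) := by
      rw [Lagrange.eval_nodal, hs, Finset.prod_range_succ', mul_comm]
      simp [hv]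
    have e2 : N.eval 0 = (-1)^n * n.factorial := by
      rw [hN, eval_prod, ← Finset.prod_range_add_one_eq_factorial]
      push_cast
      simp only [eval_sub, eval_X, eval_C, zero_sub]
      rw [Finset.prod_neg]; simp
    have e3 : N.eval (v 0) = (-1)^n * ∏ j ∈ Finset.range n, ((j:ℝ)+1+d) := by
      rw [hN, eval_prod]
      have : ∀ j ∈ Finset.range n, eval (v 0) (X - C ((j:ℝ)+1)) = -((j:ℝ)+1+d) := by
        intro j _; simp [hv]; ring
      rw [Finset.prod_congr rfl this, Finset.prod_neg]; simp
    have e4 : Lagrange.nodalWeight s v 0 = (n.factorial:ℝ)⁻¹ := by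
      rw [Lagrange.nodalWeight, ← Finset.prod_range_add_one_eq_factorial]
      have : s.erase 0 = (Finset.range n).image (·+1) := by
        ext a; simp [hs]
        constructor
        · rintro ⟨h1, h2⟩; exact ⟨a-1, by omega, by omega⟩
        · rintro ⟨b, h1, h2⟩; omega
      rw [this, Finset.prod_image (by intro a _ b _ h; simpa using h)]
      push_cast
      rw [← Finset.prod_inv_distrib]
      refine Finset.prod_congr rfl fun j _ => ?_
      simp [hv]
    have e5 : ∏ j ∈ Finset.range n, ((j:ℝ)+1+d) = n.factorial * ((n+d).choose d : ℝ) := by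
      have h := Nat.ascFactorial_eq_factorial_mul_choose d n
      rw [Nat.ascFactorial_eq_prod_range, Nat.add_comm d n, Nat.choose_symm_add] at h
      rw [← Nat.cast_mul, ← h]
      push_cast
      exact Finset.prod_congr rfl fun j _ => by ring
    have hf : (n.factorial:ℝ) ≠ 0 := by positivity
    simp only [hA]
    rw [e1, e2, e3, e4, e5]
    have : ((-1:ℝ)^n) ≠ 0 := by positivity
    field_simp

open Polynomial in
theorem one_dim (n d : ℕ) (hd : 1 ≤ d) (q : ℝ[X]) (hq : q.natDegree ≤ n) :
    (q.eval 0)^2 ≤ d * ((n+d).choose d : ℝ)^2 * ∫ r in (0:ℝ)..1, (q.eval r)^2 * r^(d-1) := by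
  obtain ⟨c, hc, hc0⟩ := kern_exists n d hd
  set k : ℝ[X] := ∑ j ∈ Finset.range (n+1), C (c j) * X^j with hk
  have hkdeg : k.natDegree ≤ n := by
    apply Polynomial.natDegree_sum_le_of_forall_le
    intro j hj
    simp at hj
    exact (natDegree_C_mul_X_pow_le _ _).trans (by omega)
  have ii : ∀ p : ℝ[X], IntervalIntegrable (fun r => p.eval r) volume 0 1 :=
    fun p => p.continuous.intervalIntegrable _ _
  have rep : ∀ p : ℝ[X], p.natDegree ≤ n →
      ∫ r in (0:ℝ)..1, (p.eval r * k.eval r * r^(d-1)) = p.eval 0 := by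
    intro p hp
    have : ∀ r : ℝ, p.eval r * k.eval r * r^(d-1) =
        ∑ i ∈ Finset.range (n+1), ∑ j ∈ Finset.range (n+1), p.coeff i * c j * r^(i+j+(d-1)) := by
      intro r
      rw [Polynomial.eval_eq_sum_range' (Nat.lt_succ_of_le hp), hk, eval_finsetSum,
        Finset.sum_mul_sum, Finset.sum_mul]
      refine Finset.sum_congr rfl fun i _ => ?_
      rw [Finset.sum_mul]
      refine Finset.sum_congr rfl fun j _ => ?_
      simp; ring
    simp_rw [this]
    rw [intervalIntegral.integral_finsetSum]
    swap
    · intro i _; apply Continuous.intervalIntegrable; fun_prop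
    have h2 : ∀ i ∈ Finset.range (n+1), ∫ r in (0:ℝ)..1, ∑ j ∈ Finset.range (n+1), p.coeff i * c j * r^(i+j+(d-1))
        = p.coeff i * if i = 0 then 1 else 0 := by
      intro i hi
      rw [← hc i (by simp at hi; omega), intervalIntegral.integral_finsetSum, Finset.mul_sum]
      swap
      · intro i _; apply Continuous.intervalIntegrable; fun_prop
      refine Finset.sum_congr rfl fun j _ => ?_
      rw [intervalIntegral.integral_const_mul, integral_pow]
      have : ((i+j+(d-1):ℕ):ℝ) + 1 = i+j+d := by
        push_cast [Nat.cast_sub hd]; ring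
      rw [this]; simp; ring
    rw [Finset.sum_congr rfl h2]
    simp [coeff_zero_eq_eval_zero]
  have k0 : k.eval 0 = d * ((n+d).choose d : ℝ)^2 := by
    rw [← hc0, hk, eval_finsetSum, Finset.sum_range_succ']; simp
  rw [← k0]
  have kpos : 0 < k.eval 0 := by
    rw [k0]
    have : 0 < (n+d).choose d := Nat.choose_pos (by omega)
    positivity
  set a := q.eval 0 / k.eval 0 with ha
  have h0 : 0 ≤ ∫ r in (0:ℝ)..1, (q.eval r - a * k.eval r)^2 * r^(d-1) := by
    apply intervalIntegral.integral_nonneg zero_le_one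
    intro r hr
    have := hr.1
    positivity
  have h1 : ∫ r in (0:ℝ)..1, (q.eval r - a * k.eval r)^2 * r^(d-1) =
     (∫ r in (0:ℝ)..1, (q.eval r)^2 * r^(d-1)) - 2 * a * (∫ r in (0:ℝ)..1, q.eval r * k.eval r * r^(d-1))
      + a^2 * ∫ r in (0:ℝ)..1, k.eval r * k.eval r * r^(d-1) := by
    rw [← intervalIntegral.integral_const_mul, ← intervalIntegral.integral_const_mul,
      ← intervalIntegral.integral_sub, ← intervalIntegral.integral_add]
    · congr 1; ext r; ring
    all_goals (apply Continuous.intervalIntegrable; fun_prop)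
  rw [h1, rep q hq, rep k hkdeg] at h0
  have h2 : a * k.eval 0 = q.eval 0 := by rw [ha]; field_simp
  have h3 : a * q.eval 0 ≤ ∫ r in (0:ℝ)..1, (q.eval r)^2 * r^(d-1) := by
    have h4 : a^2 * k.eval 0 = a * q.eval 0 := by rw [← h2]; ring
    rw [h4] at h0
    linarith
  calc (q.eval 0)^2 = k.eval 0 * (a * q.eval 0) := by rw [← h2]; ring
    _ ≤ _ := by gcongr

open Polynomial in
theorem one_dim_R (n d : ℕ) (hd : 1 ≤ d) (q : ℝ[X]) (hq : q.natDegree ≤ n) (R : ℝ) (hR : 0 < R) :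
    (q.eval 0)^2 * (∫ r in (0:ℝ)..R, r^(d-1)) ≤
      ((n+d).choose d : ℝ)^2 * ∫ r in (0:ℝ)..R, (q.eval r)^2 * r^(d-1) := by
  have h := one_dim n d hd (q.comp (C R * X)) (by
    rw [natDegree_comp]
    have : (C R * X : ℝ[X]).natDegree ≤ 1 := by
      simpa using natDegree_C_mul_X_pow_le R 1
    nlinarith)
  have h2 := intervalIntegral.mul_integral_comp_mul_left (a := 0) (b := 1)
    (f := fun r : ℝ => (q.eval r)^2 * r^(d-1)) R
  simp only [mul_zero, mul_one] at h2
  rw [integral_pow, ← h2]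
  have h3 : ((d-1:ℕ):ℝ) + 1 = d := by push_cast [Nat.cast_sub hd]; ring
  have h4 : d - 1 + 1 = d := by omega
  rw [h3, h4]
  have h5 : ∫ x in (0:ℝ)..1, (q.eval (R*x))^2 * (R*x)^(d-1) =
      R^(d-1) * ∫ x in (0:ℝ)..1, ((q.comp (C R * X)).eval x)^2 * x^(d-1) := by
    rw [← intervalIntegral.integral_const_mul]
    congr 1; ext x; simp; ring
  rw [h5]
  have hd0 : (0:ℝ) < d := by exact_mod_cast hd
  have h6 : R * R^(d-1) = R^d := by rw [← pow_succ', h4]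
  simp only [eval_comp, eval_mul, eval_C, eval_X, mul_zero] at h ⊢
  calc _ = (R^d/d) * (q.eval 0)^2 := by
        rw [zero_pow (by omega)]; ring
    _ ≤ _ := mul_le_mul_of_nonneg_left h (by positivity)
    _ = _ := by rw [← h6]; field_simp

theorem polar_lintegral {E : Type*} [NormedAddCommGroup E] [NormedSpace ℝ E] [MeasurableSpace E]
    [BorelSpace E] [FiniteDimensional ℝ E] [Nontrivial E] (μ : Measure E) [μ.IsAddHaarMeasure]
    (F : E → ENNReal) (hF : Measurable F) :
    ∫⁻ y, F y ∂μ = ∫⁻ ω : Metric.sphere (0:E) 1, (∫⁻ r in Set.Ioi (0:ℝ),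
      ENNReal.ofReal (r^(Module.finrank ℝ E - 1)) * F (r • (ω:E))) ∂μ.toSphere := by
  have h1 : ∫⁻ y, F y ∂μ = ∫⁻ y : ({(0:E)}ᶜ : Set E), F y.1 ∂(μ.comap (↑)) := by
    rw [lintegral_subtype_comap (measurableSet_singleton _).compl, restrict_compl_singleton]
  have hmp := μ.measurePreserving_homeomorphUnitSphereProd
  have h2 := hmp.symm (homeomorphUnitSphereProd E).toMeasurableEquiv
  have h3 := h2.lintegral_comp (f := fun y : ({(0:E)}ᶜ : Set E) => F y.1)
    (hF.comp measurable_subtype_coe)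
  rw [h1, ← h3]
  have hm : Measurable (fun a : Metric.sphere (0:E) 1 × Set.Ioi (0:ℝ) => F ((a.2:ℝ) • (a.1:E))) := by
    apply hF.comp
    fun_prop
  have h4 : ∀ a : Metric.sphere (0:E) 1 × Set.Ioi (0:ℝ),
    F ((homeomorphUnitSphereProd E).toMeasurableEquiv.symm a).1 = F ((a.2:ℝ) • (a.1:E)) := by
    intro a; rfl
  simp_rw [h4]
  rw [lintegral_prod _ hm.aemeasurable]
  refine lintegral_congr fun ω => ?_
  rw [Measure.volumeIoiPow, lintegral_withDensity_eq_lintegral_mul₀]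
  · rw [← lintegral_subtype_comap measurableSet_Ioi]
    rfl
  · fun_prop
  · exact (hm.comp measurable_prodMk_left).aemeasurable

open Polynomial in
theorem ray_ineq {E : Type*} [NormedAddCommGroup E] [NormedSpace ℝ E]
    (S : Set E) (hS : Convex ℝ S) (hc : IsCompact S) (x : E) (hx : x ∈ S) (ω : E) (hω : ‖ω‖ = 1)
    (n d : ℕ) (hd : 1 ≤ d) (q : ℝ[X]) (hq : q.natDegree ≤ n) :
    ∫⁻ r in Set.Ioi (0:ℝ), ENNReal.ofReal (r^(d-1)) *
        S.indicator (fun _ => ENNReal.ofReal ((q.eval 0)^2)) (x + r • ω) ≤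
    ENNReal.ofReal (((n+d).choose d : ℝ)^2) * ∫⁻ r in Set.Ioi (0:ℝ), ENNReal.ofReal (r^(d-1)) *
        S.indicator (fun _ => ENNReal.ofReal ((q.eval r)^2)) (x + r • ω) := by
  set T : Set ℝ := {r | 0 ≤ r ∧ x + r • ω ∈ S} with hT
  have hTc : IsClosed T := by
    apply isClosed_Ici.inter
    exact hc.isClosed.preimage (by fun_prop : Continuous fun r : ℝ => x + r • ω)
  have hTb : BddAbove T := by
    obtain ⟨B, hB⟩ := hc.isBounded.exists_norm_le
    refine ⟨B + ‖x‖, ?_⟩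
    rintro r ⟨h0, h1⟩
    have h2 := hB _ h1
    have h3 : ‖r • ω‖ ≤ ‖x + r • ω‖ + ‖x‖ := by
      have := norm_sub_le (x + r • ω) x
      simpa using this
    rw [norm_smul, hω, mul_one, Real.norm_of_nonneg h0] at h3
    linarith
  have hT0 : (0:ℝ) ∈ T := by simp [hT, hx]
  set R := sSup T with hR
  have hRT : R ∈ T := hTc.csSup_mem ⟨0, hT0⟩ hTb
  have hTI : ∀ r, 0 < r → (x + r • ω ∈ S ↔ r ≤ R) := by
    intro r hr
    constructor
    · intro h; exact le_csSup hTb ⟨hr.le, h⟩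
    · intro h
      have hRp : 0 < R := lt_of_lt_of_le hr h
      have := hS hx hRT.2 (a := 1 - r/R) (b := r/R)
        (by rw [sub_nonneg, div_le_one hRp]; exact h) (by positivity) (by ring)
      convert this using 1
      rw [smul_add, smul_smul, ← add_assoc, ← add_smul, div_mul_cancel₀ _ hRp.ne']
      simp
  have conv : ∀ g : ℝ → ℝ, Continuous g → (∀ r, 0 ≤ g r) →
      ∫⁻ r in Set.Ioi (0:ℝ), ENNReal.ofReal (r^(d-1)) *
        S.indicator (fun _ => ENNReal.ofReal (g r)) (x + r • ω) =
      ENNReal.ofReal (∫ r in (0:ℝ)..R, g r * r^(d-1)) := by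
    intro g hg hg0
    rw [intervalIntegral.integral_of_le hRT.1, ofReal_integral_eq_lintegral_ofReal]
    · have e : Set.Ioc 0 R = Set.Ioi 0 ∩ Set.Iic R := rfl
      rw [e, Set.inter_comm, ← Measure.restrict_restrict measurableSet_Iic, ← lintegral_indicator measurableSet_Iic]
      refine setLIntegral_congr_fun measurableSet_Ioi fun r hr => ?_
      have := hTI r hr
      by_cases h : r ≤ R
      · simp only [Set.indicator, this, h, Set.mem_Iic, if_true]
        rw [mul_comm, ENNReal.ofReal_mul (hg0 r)]
      · simp only [Set.indicator, this, h, Set.mem_Iic, if_false, mul_zero]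
    · exact (Continuous.intervalIntegrable (by fun_prop) 0 R).1
    · filter_upwards [ae_restrict_mem measurableSet_Ioc] with r hr
      have := hr.1
      have := hg0 r
      simp only [Pi.zero_apply]
      positivity
  rw [conv (fun _ => (q.eval 0)^2) (by fun_prop) (fun _ => by positivity),
    conv (fun r => (q.eval r)^2) (by fun_prop) (fun _ => by positivity),
    ← ENNReal.ofReal_mul (by positivity)]
  apply ENNReal.ofReal_le_ofReal
  rcases hRT.1.eq_or_lt with h | h
  · rw [← h]; simp
  · rw [intervalIntegral.integral_const_mul]
    exact one_dim_R n d hd q hq R h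

open Polynomial in
theorem nikolskii {E : Type*} [NormedAddCommGroup E] [NormedSpace ℝ E] [MeasurableSpace E]
    [BorelSpace E] [FiniteDimensional ℝ E] [Nontrivial E] (μ : Measure E) [μ.IsAddHaarMeasure]
    (S : Set E) (hS : Convex ℝ S) (hc : IsCompact S) (x : E) (hx : x ∈ S)
    (n : ℕ) (f : E → ℝ) (hf : Continuous f)
    (hpoly : ∀ ω : E, ∃ q : ℝ[X], q.natDegree ≤ n ∧ ∀ r : ℝ, f (x + r • ω) = q.eval r) :
    (f x)^2 * μ.real S ≤ ((n + Module.finrank ℝ E).choose (Module.finrank ℝ E) : ℝ)^2 *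
      ∫ y in S, (f y)^2 ∂μ := by
  set d := Module.finrank ℝ E with hdd
  have hd : 1 ≤ d := Module.finrank_pos
  have hSm := hc.measurableSet
  have htr : ∀ g : E → ENNReal, Measurable g → ∫⁻ y in S, g y ∂μ =
     ∫⁻ ω : Metric.sphere (0:E) 1, (∫⁻ r in Set.Ioi (0:ℝ),
      ENNReal.ofReal (r^(d - 1)) * S.indicator g (x + r • (ω:E))) ∂μ.toSphere := by
    intro g hg
    rw [← lintegral_indicator hSm, ← lintegral_add_left_eq_self _ x]
    exact polar_lintegral μ (fun y => S.indicator g (x + y))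
      ((hg.indicator hSm).comp (measurable_const_add x))
  have main : ∫⁻ y in S, ENNReal.ofReal ((f x)^2) ∂μ ≤
      ENNReal.ofReal (((n+d).choose d : ℝ)^2) * ∫⁻ y in S, ENNReal.ofReal ((f y)^2) ∂μ := by
    rw [htr _ measurable_const, htr _ (by fun_prop), ← lintegral_const_mul' _ _ ENNReal.ofReal_ne_top]
    apply lintegral_mono
    intro ω
    obtain ⟨q, hq, hq2⟩ := hpoly ω
    have h0 : f x = q.eval 0 := by rw [← hq2 0]; simp
    have := ray_ineq S hS hc x hx ω (by simp) n d hd q hq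
    rw [h0]
    refine this.trans (le_of_eq ?_)
    congr 1
    refine lintegral_congr fun r => ?_
    congr 1
    by_cases h : x + r • (ω:E) ∈ S
    · simp [h, hq2]
    · simp [h]
  have hfact : IntegrableOn (fun y => (f y)^2) S μ :=
    (by fun_prop : Continuous fun y => (f y)^2).continuousOn.integrableOn_compact hc
  rw [← ofReal_integral_eq_lintegral_ofReal hfact (by filter_upwards with y; positivity),
    ← ENNReal.ofReal_mul (by positivity), setLIntegral_const] at main
  have h2 := ENNReal.toReal_mono ENNReal.ofReal_ne_top main
  rw [ENNReal.toReal_mul, ENNReal.toReal_ofReal (by positivity), ENNReal.toReal_ofReal] at h2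
  · exact h2
  · have : 0 ≤ ∫ y in S, (f y)^2 ∂μ := integral_nonneg fun y => by positivity
    positivity

theorem iteratedDeriv_poly (p : Polynomial ℝ) (k : ℕ) :
    iteratedDeriv k (fun x => p.eval x) = fun x => (Polynomial.derivative^[k] p).eval x := by
  induction k with
  | zero => simp
  | succ k ih =>
    rw [iteratedDeriv_succ, ih, Function.iterate_succ_apply']
    ext x; simp

open Polynomial in
theorem jac_poly (a b k : ℕ) (hk : 1 ≤ k) : ∃ Q S : ℝ[X], Q.natDegree ≤ k ∧ S.eval 1 = 0 ∧
    S.eval (-1) = 0 ∧ derivative S = (1 - X)^a * (1 + X)^b * Q ∧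
    (∀ t : ℝ, (1-t)^a * (1+t)^b ≠ 0 → jacobiP a b k t = Q.eval t) := by
  set F : ℝ[X] := (1 - X)^a * (1 + X)^b * (1 - X^2)^k with hF
  have hF2 : F = (1 - X)^(a+k) * (1+X)^(b+k) := by
    rw [hF, show (1 - X^2 : ℝ[X]) = (1 - X) * (1+X) by ring, mul_pow]; ring
  have d1 : ∀ l, (1 - X : ℝ[X])^(a+k-l) ∣ derivative^[l] F := fun l =>
    pow_sub_dvd_iterate_derivative_of_pow_dvd l (hF2 ▸ Dvd.intro _ rfl)
  have d2 : ∀ l, (1 + X : ℝ[X])^(b+k-l) ∣ derivative^[l] F := fun l =>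
    pow_sub_dvd_iterate_derivative_of_pow_dvd l (hF2 ▸ Dvd.intro_left _ rfl)
  have hcop : IsCoprime (1 - X : ℝ[X]) (1 + X) := by
    refine ⟨C (1/2), C (1/2), ?_⟩
    rw [← mul_add, show (1 - X + (1 + X) : ℝ[X]) = C 2 by
      rw [show (C 2 : ℝ[X]) = 2 from rfl]; ring, ← C_mul]
    norm_num
  have hdvd : (1 - X : ℝ[X])^a * (1 + X)^b ∣ derivative^[k] F := by
    have h1 := d1 k
    have h2 := d2 k
    rw [Nat.add_sub_cancel] at h1 h2
    exact (hcop.pow).mul_dvd h1 h2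
  obtain ⟨Q, hQ⟩ := hdvd
  have n1 : (1 - X : ℝ[X]).natDegree = 1 := by
    rw [← natDegree_neg, neg_sub]; exact natDegree_X_sub_C (1:ℝ)
  have n2 : (1 + X : ℝ[X]).natDegree = 1 := by
    rw [add_comm]; exact natDegree_X_add_C (1:ℝ)
  have z1 : (1 - X : ℝ[X]) ≠ 0 := by intro h; rw [h] at n1; simp at n1
  have z2 : (1 + X : ℝ[X]) ≠ 0 := by intro h; rw [h] at n2; simp at n2
  have hQdeg : Q.natDegree ≤ k := by
    by_cases hQ0 : Q = 0
    · simp [hQ0]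
    have h1 := natDegree_iterate_derivative F k
    rw [hQ, hF2, natDegree_mul (by positivity) (by positivity),
      natDegree_mul (by positivity) (by positivity),
      natDegree_mul (by positivity) (by positivity)] at h1
    simp only [natDegree_pow, n1, n2] at h1
    omega
  set c : ℝ := (-1)^k / ((2:ℝ)^k * (k.factorial : ℝ)) with hc
  refine ⟨C c * Q, C c * derivative^[k-1] F, (natDegree_C_mul_le _ _).trans hQdeg, ?_, ?_, ?_, ?_⟩
  · have := d1 (k-1)
    obtain ⟨G, hG⟩ := this
    rw [hG]; simp [show a + k - (k-1) ≠ 0 by omega]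
  · have := d2 (k-1)
    obtain ⟨G, hG⟩ := this
    rw [hG]; simp [show b + k - (k-1) ≠ 0 by omega]
  · rw [derivative_C_mul, ← Function.iterate_succ_apply' derivative, Nat.succ_eq_add_one, Nat.sub_add_cancel hk, hQ]
    ring
  · intro t ht
    have : (fun s : ℝ => (1-s)^a * (1+s)^b * (1-s^2)^k) = fun s => F.eval s := by
      ext s; simp [hF]
    rw [jacobiP, this, iteratedDeriv_poly, hQ]
    simp only [eval_mul, eval_pow, eval_sub, eval_add, eval_one, eval_X, eval_C]
    rw [hc]
    field_simp
    exact mul_div_cancel_left₀ _ ht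

theorem jac_zero (a b k : ℕ) (t : ℝ) (h : (1-t)^a * (1+t)^b = 0) : jacobiP a b k t = 0 := by
  simp [jacobiP, h]

open Polynomial in
theorem term_poly (d i n : ℕ) (θ : Fin n → ℝ) : ∃ G : ℝ[X], G.natDegree ≤ n ∧
    (∃ ξ ∈ Set.Icc (0:ℝ) 1, G.eval ξ = 0) ∧
    (∀ t ∈ Set.Ioo (0:ℝ) 1, ∑ k, θ k * phiB d i (k.1+1) t = G.eval t) ∧
    (∀ t : ℝ, ∑ k, θ k * phiB d i (k.1+1) t = G.eval t ∨
      ∑ k, θ k * phiB d i (k.1+1) t = 0) := by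
  choose Q S hQ hS1 hS2 hSQ hJ using fun k : Fin n => jac_poly (d-i) (i-1) (k.1+1) (by omega)
  set c : Fin n → ℝ := fun k => θ k * (Real.sqrt ((((2*(k.1+1)+d) * (k.1+1).factorial * ((k.1+1)+d-1).factorial : ℕ) : ℝ) /
      ((((k.1+1)+d-i).factorial * ((k.1+1)+i-1).factorial : ℕ) : ℝ)) *
      Real.sqrt (((d-i).factorial * (i-1).factorial : ℕ) : ℝ)) with hc
  have hsum : ∀ t, ∑ k, θ k * phiB d i (k.1+1) t =
      ∑ k, c k * jacobiP (d-i) (i-1) (k.1+1) (2*t-1) := by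
    intro t
    refine Finset.sum_congr rfl fun k _ => ?_
    rw [phiB, hc]; ring
  set P : ℝ[X] := ∑ k, C (c k) * Q k with hP
  set G : ℝ[X] := P.comp (C 2 * X - C 1) with hG
  have hGe : ∀ t, G.eval t = P.eval (2*t-1) := by intro t; simp [hG]
  have good : ∀ t : ℝ, (1-(2*t-1))^(d-i) * (1+(2*t-1))^(i-1) ≠ 0 →
      ∑ k, θ k * phiB d i (k.1+1) t = G.eval t := by
    intro t ht
    rw [hsum, hGe, hP, eval_finsetSum]
    refine Finset.sum_congr rfl fun k _ => ?_
    rw [hJ k _ ht]; simp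
  refine ⟨G, ?_, ?_, ?_, ?_⟩
  · rw [hG, natDegree_comp]
    have h1 : (C 2 * X - C 1 : ℝ[X]).natDegree ≤ 1 := by compute_degree
    have h2 : P.natDegree ≤ n := by
      apply natDegree_sum_le_of_forall_le
      intro k _
      exact (natDegree_C_mul_le _ _).trans ((hQ k).trans (by omega))
    nlinarith
  · set U : ℝ[X] := ∑ k, C (c k) * S k with hU
    obtain ⟨u, hu, hu0⟩ := exists_hasDerivAt_eq_zero (f := fun x => U.eval x)
      (f' := fun x => U.derivative.eval x) (a := -1) (b := 1) (by norm_num)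
      U.continuous.continuousOn
      (by simp [hU, eval_finsetSum, hS1, hS2]) (fun x _ => U.hasDerivAt x)
    have hUd : derivative U = (1 - X)^(d-i) * (1 + X)^(i-1) * P := by
      rw [hU, derivative_sum, hP, Finset.mul_sum]
      refine Finset.sum_congr rfl fun k _ => ?_
      rw [derivative_C_mul, hSQ]; ring
    refine ⟨(u+1)/2, ⟨by linarith [hu.1], by linarith [hu.2]⟩, ?_⟩
    rw [hGe, show 2 * ((u+1)/2) - 1 = u by ring]
    simp only [hUd] at hu0
    rw [eval_mul] at hu0
    rcases mul_eq_zero.1 hu0 with h | h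
    · exfalso
      have h1 : 0 < 1 - u := by linarith [hu.2]
      have h2 : 0 < 1 + u := by linarith [hu.1]
      have : 0 < (1-u)^(d-i) * (1+u)^(i-1) := by positivity
      simp only [eval_mul, eval_pow, eval_sub, eval_add, eval_one, eval_X] at h
      linarith
    · exact h
  · intro t ht
    apply good
    have h1 : 0 < 1 - (2*t-1) := by linarith [ht.2]
    have h2 : 0 < 1 + (2*t-1) := by linarith [ht.1]
    positivity
  · intro t
    by_cases h : (1-(2*t-1))^(d-i) * (1+(2*t-1))^(i-1) = 0
    · right
      rw [hsum]
      exact Finset.sum_eq_zero fun k _ => by rw [jac_zero _ _ _ _ h, mul_zero]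
    · exact Or.inl (good t h)

theorem simplex_compact (d : ℕ) : IsCompact (simplexD d) := by
  have h : IsCompact (Set.univ.pi fun _ : Fin d => Set.Icc (0:ℝ) 1) :=
    isCompact_univ_pi fun _ => isCompact_Icc
  refine h.of_isClosed_subset ?_ fun x hx i _ => hx.1 i
  have : simplexD d = (⋂ i, {x | x i ∈ Set.Icc (0:ℝ) 1}) ∩ ⋂ i : Fin d, ⋂ j : Fin d, ⋂ _ : i ≤ j, {x | x i ≤ x j} := by
    ext x; simp [simplexD]
  rw [this]
  refine IsClosed.inter (isClosed_iInter fun i => isClosed_Icc.preimage (continuous_apply i)) ?_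
  exact isClosed_iInter fun i => isClosed_iInter fun j => isClosed_iInter fun _ =>
    isClosed_le (continuous_apply i) (continuous_apply j)

theorem simplex_convex (d : ℕ) : Convex ℝ (simplexD d) := by
  intro x hx y hy a b ha hb hab
  refine ⟨fun i => ?_, fun i j hij => ?_⟩
  · exact convex_Icc (0:ℝ) 1 (hx.1 i) (hy.1 i) ha hb hab
  · simp only [Pi.add_apply, Pi.smul_apply, smul_eq_mul]
    have := hx.2 i j hij
    have := hy.2 i j hij
    gcongr

theorem simplex_vol (d : ℕ) : 1 ≤ (d.factorial : ℝ) * volume.real (simplexD d) := by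
  have hcov : (Set.univ.pi fun _ : Fin d => Set.Icc (0:ℝ) 1) ⊆
      ⋃ σ : Equiv.Perm (Fin d), {x | x ∘ σ ∈ simplexD d} := by
    intro x hx
    rw [Set.mem_iUnion]
    exact ⟨Tuple.sort x, fun i => hx _ trivial, fun i j hij => Tuple.monotone_sort x hij⟩
  have hv : ∀ σ : Equiv.Perm (Fin d), volume {x : Fin d → ℝ | x ∘ σ ∈ simplexD d} = volume (simplexD d) := by
    intro σ
    have := volume_preserving_arrowCongr' σ.symm (MeasurableEquiv.refl ℝ) (.id volume)
    rw [← this.measure_preimage (simplex_compact d).measurableSet.nullMeasurableSet]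
    rfl
  have h1 : volume (Set.univ.pi fun _ : Fin d => Set.Icc (0:ℝ) 1) = 1 := by
    rw [volume_pi_pi]; simp
  have h2 := (measure_mono hcov).trans (measure_iUnion_le (μ := volume) _)
  rw [h1] at h2
  simp only [hv, tsum_fintype, Finset.sum_const, Finset.card_univ, Fintype.card_perm, Fintype.card_fin, nsmul_eq_mul] at h2
  have h3 := ENNReal.toReal_mono (ENNReal.mul_ne_top (by simp) (simplex_compact d).measure_lt_top.ne) h2
  simpa [ENNReal.toReal_mul, Measure.real] using h3

/-- Sup-norm vs L²-norm bound on the linear span `S_m`. -/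
theorem statement14 (d : ℕ) (hd : 2 ≤ d) (m : Fin d → ℕ) (hm : ∀ i, 1 ≤ m i)
    (θ : (i : Fin d) → Fin (m i) → ℝ) :
    ∀ x ∈ simplexD d,
      |lincomb d m θ x| ≤
        Real.sqrt (2 * (d.factorial : ℝ)) * Real.sqrt (∑ i, ((m i + d : ℕ) : ℝ)^(2*d)) *
        Real.sqrt (∫ y in simplexD d, (lincomb d m θ y)^2) := by
  classical
  intro x hx
  have hd0 : 0 < d := by omega
  have : Nonempty (Fin d) := ⟨⟨0, hd0⟩⟩
  choose G hGdeg hGz hGin hGor using fun i : Fin d => term_poly d (i.1+1) (m i) (θ i)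
  set g : (Fin d → ℝ) → ℝ := fun y => ∑ i, (G i).eval (y i) with hg
  obtain ⟨i0, hi0⟩ := Finite.exists_max m
  set n := m i0 with hn
  set I := ∫ y in simplexD d, (lincomb d m θ y)^2 with hI
  have hIg : I = ∫ y in simplexD d, (g y)^2 := by
    rw [hI]
    apply integral_congr_ae
    have hae : ∀ᵐ y : Fin d → ℝ, ∀ i, y i ≠ 0 ∧ y i ≠ 1 := by
      rw [ae_all_iff]
      intro i
      have h0 : ∀ a : ℝ, ∀ᵐ y : Fin d → ℝ, y i ≠ a := fun a => by
        rw [ae_iff]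
        simp only [ne_eq, not_not]
        exact Measure.pi_hyperplane (fun _ : Fin d => (volume : Measure ℝ)) i a
      filter_upwards [h0 0, h0 1] with y h1 h2 using ⟨h1, h2⟩
    filter_upwards [ae_restrict_of_ae hae, ae_restrict_mem (simplex_compact d).measurableSet] with y hy hyS
    have : lincomb d m θ y = g y := by
      rw [lincomb, hg]
      refine Finset.sum_congr rfl fun i _ => ?_
      apply hGin i
      exact ⟨lt_of_le_of_ne (hyS.1 i).1 (hy i).1.symm, lt_of_le_of_ne (hyS.1 i).2 (hy i).2⟩
    simp only [this]
  have hI0 : 0 ≤ I := integral_nonneg fun y => by positivity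
  set D : ℝ := (d.factorial : ℝ) with hD
  have hDpos : 0 < D := by rw [hD]; positivity
  set N : ℝ := ((n+d:ℕ):ℝ)^(2*d) with hN
  have hN0 : 0 ≤ N := by rw [hN]; positivity
  set M := Real.sqrt (N / D * I) with hM
  have hM2 : M^2 = N / D * I := Real.sq_sqrt (by positivity)
  have hM0 : 0 ≤ M := Real.sqrt_nonneg _
  have hgc : Continuous g := by
    rw [hg]
    exact continuous_finsetSum _ fun i _ => (G i).continuous.comp (continuous_apply i)
  -- the sup bound for the polynomial version
  have hsup : ∀ y ∈ simplexD d, |g y| ≤ M := by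
    intro y hy
    apply Real.abs_le_sqrt
    have hnik := nikolskii (volume : Measure (Fin d → ℝ)) (simplexD d) (simplex_convex d)
      (simplex_compact d) y hy n g hgc (by
        intro ω
        refine ⟨∑ i, (G i).comp (Polynomial.C (y i) + Polynomial.C (ω i) * Polynomial.X), ?_, ?_⟩
        · apply Polynomial.natDegree_sum_le_of_forall_le
          intro i _
          rw [Polynomial.natDegree_comp]
          have h1 : (Polynomial.C (y i) + Polynomial.C (ω i) * Polynomial.X).natDegree ≤ 1 := by
            compute_degree
          have h2 := (hGdeg i).trans (hi0 i)
          nlinarith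
        · intro r
          simp only [hg, Polynomial.eval_finsetSum, Polynomial.eval_comp]
          refine Finset.sum_congr rfl fun i _ => ?_
          have e : (y + r • ω) i = y i + ω i * r := by
            rw [Pi.add_apply, Pi.smul_apply, smul_eq_mul, mul_comm]
          rw [e]
          simp only [Polynomial.eval_add, Polynomial.eval_mul, Polynomial.eval_C, Polynomial.eval_X])
    rw [Module.finrank_fin_fun, ← hIg] at hnik
    have hvol := simplex_vol d
    have hch : D * ((n+d).choose d : ℝ) ≤ ((n+d:ℕ):ℝ)^d := by
      rw [hD, ← Nat.cast_mul, ← Nat.descFactorial_eq_factorial_mul_choose]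
      exact_mod_cast Nat.descFactorial_le_pow _ _
    have hch2 : (D * ((n+d).choose d : ℝ))^2 ≤ N := by
      rw [hN, mul_comm 2 d, pow_mul]
      gcongr
    calc (g y)^2 ≤ (g y)^2 * (D * volume.real (simplexD d)) :=
          le_mul_of_one_le_right (by positivity) hvol
      _ = D * ((g y)^2 * volume.real (simplexD d)) := by ring
      _ ≤ D * (((n+d).choose d : ℝ)^2 * I) := by gcongr
      _ = (D * ((n+d).choose d : ℝ))^2 / D * I := by field_simp
      _ ≤ N / D * I := by gcongr
  -- individual bounds
  have hind : ∀ i, ∀ t ∈ Set.Icc (0:ℝ) 1, |(G i).eval t| ≤ 2 * M := by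
    intro i t ht
    obtain ⟨ξ, hξ, hξ0⟩ := hGz i
    set p : ℝ → Fin d → ℝ := fun s j => if j < i then 0 else if j = i then s else 1 with hp
    have hpS : ∀ s ∈ Set.Icc (0:ℝ) 1, p s ∈ simplexD d := by
      intro s hs
      refine ⟨fun j => ?_, fun j k hjk => ?_⟩
      · simp only [hp]
        split_ifs
        · simp
        · exact hs
        · simp
      · have h1 := hs.1
        have h2 := hs.2
        simp only [hp]
        split_ifs <;> first | linarith | (exfalso; omega)
    have hdiff : g (p t) - g (p ξ) = (G i).eval t := by
      simp only [hg, ← Finset.sum_sub_distrib]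
      rw [Finset.sum_eq_single i]
      · simp [hp, hξ0]
      · intro j _ hj
        simp [hp, hj]
      · simp
    rw [← hdiff]
    have h1 := hsup _ (hpS t ht)
    have h2 := hsup _ (hpS ξ hξ)
    have h3 := abs_sub (g (p t)) (g (p ξ))
    linarith
  have hNle : N ≤ ∑ i, ((m i + d : ℕ) : ℝ)^(2*d) :=
    Finset.single_le_sum (f := fun i => ((m i + d : ℕ) : ℝ)^(2*d)) (fun i _ => by positivity)
      (Finset.mem_univ i0)
  have hdR : (2:ℝ) ≤ d := by exact_mod_cast hd
  -- bound by 2 (d-1) M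
  have hfin : |lincomb d m θ x| ≤ 2 * ((d:ℝ) - 1) * M := by
    by_cases hall : ∀ i, ∑ k, θ i k * phiB d (i.1+1) (k.1+1) (x i) = (G i).eval (x i)
    · have : lincomb d m θ x = g x := by
        rw [lincomb, hg]
        exact Finset.sum_congr rfl fun i _ => hall i
      rw [this]
      have := hsup x hx
      nlinarith
    · push Not at hall
      obtain ⟨j, hj⟩ := hall
      have hj0 := (hGor j (x j)).resolve_left hj
      rw [lincomb, ← Finset.sum_erase (f := fun i : Fin d => ∑ k, θ i k * phiB d (i.1+1) (k.1+1) (x i)) _ hj0]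
      refine (Finset.abs_sum_le_sum_abs _ _).trans ?_
      have hle : ∀ i ∈ Finset.univ.erase j,
          |∑ k, θ i k * phiB d (i.1+1) (k.1+1) (x i)| ≤ 2 * M := by
        intro i _
        rcases hGor i (x i) with h | h
        · rw [h]; exact hind i _ (hx.1 i)
        · rw [h]; simpa using hM0
      refine (Finset.sum_le_card_nsmul _ _ _ hle).trans (le_of_eq ?_)
      rw [Finset.card_erase_of_mem (Finset.mem_univ j), Finset.card_univ, Fintype.card_fin,
        nsmul_eq_mul, Nat.cast_sub (by omega)]
      push_cast; ring
  have hDd : (d:ℝ) * ((d:ℝ) - 1) ≤ D := by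
    obtain ⟨e, rfl⟩ : ∃ e, d = e + 2 := ⟨d - 2, by omega⟩
    rw [hD, Nat.factorial_succ, Nat.factorial_succ]
    have : (1:ℝ) ≤ (e.factorial : ℝ) := by exact_mod_cast Nat.one_le_iff_ne_zero.2 e.factorial_ne_zero
    push_cast
    have h2 : (0:ℝ) ≤ ((e:ℝ)+2) * (e+1) := by positivity
    nlinarith
  rw [← Real.sqrt_mul (by positivity), ← Real.sqrt_mul (by positivity)]
  refine hfin.trans (Real.le_sqrt_of_sq_le ?_)
  have h2D : 2 * ((d:ℝ) - 1) ≤ D := by nlinarith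
  have hd1 : 0 ≤ 2 * ((d:ℝ) - 1) := by linarith
  calc (2 * ((d:ℝ) - 1) * M)^2 = (2 * ((d:ℝ) - 1))^2 * (N / D * I) := by rw [mul_pow, hM2]
    _ ≤ D^2 * (N / D * I) := by gcongr
    _ = D * N * I := by field_simp
    _ ≤ (2 * D) * (∑ i, ((m i + d : ℕ) : ℝ)^(2*d)) * I := by
      gcongr
      linarith
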